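/- arXiv:1601.00999 — 2 statements merged into one kernel-verified Lean document; each statement's English description precedes it below -/
import Mathlib

section
/- Fix an integer n ≥ 2 and assume x₀ = y₀ = R > 0. There exists a value p_n such that for every p ≥ p_n one has λ_{1,p}(σ) < sup{λ_{1,p}(α) : α ∈ 𝒞}. -/
open Set MeasureTheory Filter Topology

noncomputable section

/-- The closed quarter plane `P`. -/
def Pset : Set (ℝ × ℝ) := {z | 0 ≤ z.1 ∧ 0 ≤ z.2}

/-- The interior `P°` of the quarter plane. -/
def Pint : Set (ℝ × ℝ) := {z | 0 < z.1 ∧ 0 < z.2}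

/-- The boundary `∂P` of the quarter plane. -/
def Pbdry : Set (ℝ × ℝ) := {z | (0 ≤ z.1 ∧ 0 ≤ z.2) ∧ (z.1 = 0 ∨ z.2 = 0)}

/-- `F(x,y) = c_n x^(n-1) y^(n-1)`. -/
def Fvol (n : ℕ) (cn : ℝ) (z : ℝ × ℝ) : ℝ := cn * z.1 ^ (n - 1) * z.2 ^ (n - 1)

/-- Euclidean speed of a curve at `t`, computed with derivatives within `s`. -/
def gSpeedOn (s : Set ℝ) (α : ℝ → ℝ × ℝ) (t : ℝ) : ℝ :=
  Real.sqrt ((derivWithin (fun u => (α u).1) s t) ^ 2 + (derivWithin (fun u => (α u).2) s t) ^ 2)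

/-- Euclidean speed of a curve defined on `[0,1]`. -/
def gSpeed (α : ℝ → ℝ × ℝ) : ℝ → ℝ := gSpeedOn (Icc 0 1) α

/-- Euclidean length `L_g` of a curve on `[0,1]`. -/
def Lg (α : ℝ → ℝ × ℝ) : ℝ := ∫ t in (0:ℝ)..1, gSpeed α t

/-- The `h`-speed `|γ'|_h = F(γ) |γ'|_g`, with derivatives within `s`. -/
def hSpeedOn (n : ℕ) (cn : ℝ) (s : Set ℝ) (α : ℝ → ℝ × ℝ) (t : ℝ) : ℝ :=
  Fvol n cn (α t) * gSpeedOn s α t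

/-- The `h`-speed for curves defined on `[0,1)`. -/
def hSpeed (n : ℕ) (cn : ℝ) (α : ℝ → ℝ × ℝ) : ℝ → ℝ := hSpeedOn n cn (Ico 0 1) α

/-- The `h`-length `L_h` of a curve on `[0,1)`. -/
def Lh (n : ℕ) (cn : ℝ) (α : ℝ → ℝ × ℝ) : ℝ := ∫ t in (0:ℝ)..1, hSpeed n cn α t

/-- Numerator integrand of the `g`-Rayleigh quotient:
`|w'(t)|^p F(α t) |α'(t)|_g^(1-p)`. -/
def numG (n : ℕ) (cn p : ℝ) (s : Set ℝ) (α : ℝ → ℝ × ℝ) (w : ℝ → ℝ) (t : ℝ) : ℝ :=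
  |derivWithin w (Icc 0 1) t| ^ p * Fvol n cn (α t) * gSpeedOn s α t ^ (1 - p)

/-- Denominator integrand of the `g`-Rayleigh quotient:
`|w(t)|^p F(α t) |α'(t)|_g`. -/
def denG (n : ℕ) (cn p : ℝ) (s : Set ℝ) (α : ℝ → ℝ × ℝ) (w : ℝ → ℝ) (t : ℝ) : ℝ :=
  |w t| ^ p * Fvol n cn (α t) * gSpeedOn s α t

/-- First Dirichlet eigenvalue of the `p`-Laplacian along a curve, `g`-form:
infimum of the Rayleigh quotient over Lipschitz test functions on `[0,1]`
vanishing at `0` (with admissible, i.e. integrable with positive denominator,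
Rayleigh quotients). -/
def lambdaGOn (n : ℕ) (cn p : ℝ) (s : Set ℝ) (α : ℝ → ℝ × ℝ) : ℝ :=
  sInf {q | ∃ w : ℝ → ℝ, (∃ K, LipschitzOnWith K w (Icc 0 1)) ∧ w 0 = 0 ∧
    IntervalIntegrable (numG n cn p s α w) volume 0 1 ∧
    IntervalIntegrable (denG n cn p s α w) volume 0 1 ∧
    (0 < ∫ t in (0:ℝ)..1, denG n cn p s α w t) ∧
    q = (∫ t in (0:ℝ)..1, numG n cn p s α w t) / (∫ t in (0:ℝ)..1, denG n cn p s α w t)}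

/-- `λ_{1,p}` in the `g`-form for curves on `[0,1]`. -/
def lambdaG (n : ℕ) (cn p : ℝ) (α : ℝ → ℝ × ℝ) : ℝ := lambdaGOn n cn p (Icc 0 1) α

/-- Numerator integrand of the `h`-Rayleigh quotient on `[c,d]`:
`|w'(t)|^p F(γ t)^p |γ'(t)|_h^(1-p)`. -/
def numH (n : ℕ) (cn p c d : ℝ) (s : Set ℝ) (γ : ℝ → ℝ × ℝ) (w : ℝ → ℝ) (t : ℝ) : ℝ :=
  |derivWithin w (Icc c d) t| ^ p * Fvol n cn (γ t) ^ p * hSpeedOn n cn s γ t ^ (1 - p)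

/-- Denominator integrand of the `h`-Rayleigh quotient: `|w(t)|^p |γ'(t)|_h`. -/
def denH (n : ℕ) (cn p : ℝ) (s : Set ℝ) (γ : ℝ → ℝ × ℝ) (w : ℝ → ℝ) (t : ℝ) : ℝ :=
  |w t| ^ p * hSpeedOn n cn s γ t

/-- `λ_{1,p}` in the `h`-form for a curve on `[c,d)`, with test functions
Lipschitz on `[c,d]` vanishing at `c`. -/
def lambdaHOn (n : ℕ) (cn p c d : ℝ) (s : Set ℝ) (γ : ℝ → ℝ × ℝ) : ℝ :=
  sInf {q | ∃ w : ℝ → ℝ, (∃ K, LipschitzOnWith K w (Icc c d)) ∧ w c = 0 ∧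
    IntervalIntegrable (numH n cn p c d s γ w) volume c d ∧
    IntervalIntegrable (denH n cn p s γ w) volume c d ∧
    (0 < ∫ t in c..d, denH n cn p s γ w t) ∧
    q = (∫ t in c..d, numH n cn p c d s γ w t) / (∫ t in c..d, denH n cn p s γ w t)}

/-- `λ_{1,p}` in the `h`-form for curves on `[0,1)`. -/
def lambdaH (n : ℕ) (cn p : ℝ) (γ : ℝ → ℝ × ℝ) : ℝ :=
  lambdaHOn n cn p 0 1 (Ico 0 1) γ

/-- The class `𝒞` of `C¹` curves from `(x₀,y₀)` to the boundary, with constant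
speed, interior image on `[0,1)`, endpoint away from the origin, and meeting the
boundary orthogonally. -/
def MemC (x0 y0 : ℝ) (α : ℝ → ℝ × ℝ) : Prop :=
  ContDiffOn ℝ 1 α (Icc 0 1) ∧
  α 0 = (x0, y0) ∧
  (∀ t ∈ Ico (0:ℝ) 1, α t ∈ Pint) ∧
  α 1 ∈ Pbdry ∧ α 1 ≠ ((0 : ℝ), (0 : ℝ)) ∧
  (∀ t ∈ Icc (0:ℝ) 1, gSpeed α t = Lg α) ∧
  ((α 1).1 = 0 → derivWithin (fun u => (α u).2) (Icc 0 1) 1 = 0) ∧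
  ((α 1).2 = 0 → derivWithin (fun u => (α u).1) (Icc 0 1) 1 = 0)

/-- The Simons cone curve `σ(t) = (1-t)·(R,R)`. -/
def simonsCurve (R : ℝ) : ℝ → ℝ × ℝ := fun t => ((1 - t) * R, (1 - t) * R)

/-- The class `R_h`: locally Lipschitz curves on `[0,1)` with image in `P°`,
starting at `(x₀,y₀)`, with essentially bounded `h`-speed, reaching the collapsed
boundary point as `t → 1` (i.e. `x(γ t)·y(γ t) → 0`). -/
def MemRh (n : ℕ) (cn x0 y0 : ℝ) (γ : ℝ → ℝ × ℝ) : Prop :=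
  γ 0 = (x0, y0) ∧
  (∀ t ∈ Ico (0:ℝ) 1, γ t ∈ Pint) ∧
  (∀ a ∈ Ico (0:ℝ) 1, ∃ K, LipschitzOnWith K γ (Icc 0 a)) ∧
  (∃ M : ℝ, ∀ᵐ t ∂(volume : Measure ℝ), t ∈ Ico (0:ℝ) 1 → hSpeed n cn γ t ≤ M) ∧
  Tendsto (fun t => (γ t).1 * (γ t).2) (𝓝[<] (1:ℝ)) (𝓝 0)

/-- The class `R_h^+`: continuous curves on `[0,1]` into `P` ending on `∂P`
whose restriction to `[0,1)` belongs to `R_h`. -/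
def MemRhPlus (n : ℕ) (cn x0 y0 : ℝ) (α : ℝ → ℝ × ℝ) : Prop :=
  ContinuousOn α (Icc 0 1) ∧ (∀ t ∈ Icc (0:ℝ) 1, α t ∈ Pset) ∧ α 1 ∈ Pbdry ∧
  MemRh n cn x0 y0 α

/-- The class `R_g`: Lipschitz curves on `[0,1]` from `(x₀,y₀)` to `∂P` with
interior image on `[0,1)`. -/
def MemRg (x0 y0 : ℝ) (α : ℝ → ℝ × ℝ) : Prop :=
  (∃ K, LipschitzOnWith K α (Icc 0 1)) ∧ α 0 = (x0, y0) ∧ α 1 ∈ Pbdry ∧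
  ∀ t ∈ Ico (0:ℝ) 1, α t ∈ Pint

/-- The coordinate `u(x,y) = (x² - y²)/2`. -/
def ucoord (z : ℝ × ℝ) : ℝ := (z.1 ^ 2 - z.2 ^ 2) / 2

/-- The coordinate `v(x,y) = xy`. -/
def vcoord (z : ℝ × ℝ) : ℝ := z.1 * z.2

/-- The coordinate `r = √(u² + v²)`. -/
def rcoord (z : ℝ × ℝ) : ℝ := Real.sqrt (ucoord z ^ 2 + vcoord z ^ 2)

/-- The class `R_g^*`: simple curves in `R_g` with a.e. constant speed,
`u(α(1)) > 0`, and `v(α(t)) ≥ c(1-t)` for some `c > 0`. -/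
def MemRgStar (x0 y0 : ℝ) (α : ℝ → ℝ × ℝ) : Prop :=
  MemRg x0 y0 α ∧ InjOn α (Icc 0 1) ∧
  (∀ᵐ t ∂(volume : Measure ℝ), t ∈ Icc (0:ℝ) 1 → gSpeed α t = Lg α) ∧
  0 < ucoord (α 1) ∧
  ∃ c > (0:ℝ), ∀ t ∈ Icc (0:ℝ) 1, c * (1 - t) ≤ vcoord (α t)
lemma tangent_le_rpow {c x p : ℝ} (hc : 0 < c) (hx : 0 ≤ x) (hp : 1 ≤ p) :
    c ^ p + p * c ^ p * (x / c - 1) ≤ x ^ p := by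
  have h := one_add_mul_self_le_rpow_one_add (s := x / c - 1)
    (by linarith [div_nonneg hx hc.le]) hp
  rw [add_sub_cancel, Real.div_rpow hx hc.le, le_div_iff₀ (Real.rpow_pos_of_pos hc p)] at h
  linarith

lemma intervalIntegrable_abs_deriv_rpow {K : NNReal} {w : ℝ → ℝ}
    (hw : LipschitzOnWith K w (Icc 0 1)) {p : ℝ} (hp : 1 ≤ p) :
    IntervalIntegrable (fun s => |deriv w s| ^ p) volume 0 1 := by
  rw [intervalIntegrable_iff_integrableOn_Ioo_of_le zero_le_one (by simp) (by simp)]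
  refine Measure.integrableOn_of_bounded (M := (K : ℝ) ^ p) (by simp)
    (((measurable_deriv w).abs).pow_const p).aestronglyMeasurable ?_
  filter_upwards [ae_restrict_mem measurableSet_Ioo] with s hs
  have h := norm_deriv_le_of_lipschitzOn (Icc_mem_nhds hs.1 hs.2) hw
  rw [Real.norm_of_nonneg (by positivity)]
  exact Real.rpow_le_rpow (abs_nonneg _) h (by linarith)

/-- A Jensen-type bound of a Lipschitz function vanishing at `0` by its energy. -/
lemma abs_rpow_le_integral_abs_deriv_rpow {K : NNReal} {w : ℝ → ℝ}
    (hw : LipschitzOnWith K w (Icc 0 1)) (h0 : w 0 = 0) {p : ℝ} (hp : 1 ≤ p)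
    {t : ℝ} (ht : t ∈ Icc (0 : ℝ) 1) :
    |w t| ^ p ≤ ∫ s in (0 : ℝ)..t, |deriv w s| ^ p := by
  rcases eq_or_ne (w t) 0 with hz | hz
  · rw [hz, abs_zero, Real.zero_rpow (by linarith)]
    exact intervalIntegral.integral_nonneg ht.1 fun s _ => by positivity
  have hc : 0 < |w t| := abs_pos.mpr hz
  set c := |w t| with hcdef
  have hac : AbsolutelyContinuousOnInterval w 0 t :=
    LipschitzOnWith.absolutelyContinuousOnInterval (K := K)
      (hw.mono (by rw [uIcc_of_le ht.1]; exact Icc_subset_Icc_right ht.2))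
  have hint : IntervalIntegrable (fun s => |deriv w s|) volume 0 t :=
    hac.intervalIntegrable_deriv.abs
  have hftc : c ≤ ∫ s in (0 : ℝ)..t, |deriv w s| := by
    have h := intervalIntegral.abs_integral_le_integral_abs (f := deriv w) (μ := volume) ht.1
    rwa [hac.integral_deriv_eq_sub, h0, sub_zero] at h
  have hpint : IntervalIntegrable (fun s => |deriv w s| ^ p) volume 0 t :=
    (intervalIntegrable_abs_deriv_rpow hw hp).mono_set
      (by rw [uIcc_of_le ht.1, uIcc_of_le zero_le_one]; exact Icc_subset_Icc_right ht.2)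
  have hmono := intervalIntegral.integral_mono_on ht.1
    (f := fun s => (c ^ p - p * c ^ p) + (p * c ^ p / c) * |deriv w s|)
    (by simpa using intervalIntegrable_const.add (hint.const_mul _)) hpint
    (fun s _ => by
      have h := tangent_le_rpow hc (abs_nonneg (deriv w s)) hp
      refine le_trans (le_of_eq ?_) h
      ring)
  refine le_trans ?_ hmono
  rw [intervalIntegral.integral_add intervalIntegrable_const (hint.const_mul _),
    intervalIntegral.integral_const, intervalIntegral.integral_const_mul, smul_eq_mul, sub_zero]
  have hcp : 0 < c ^ p := Real.rpow_pos_of_pos hc p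
  have h1 : p * c ^ p ≤ p * c ^ p / c * ∫ s in (0 : ℝ)..t, |deriv w s| := by
    calc p * c ^ p = p * c ^ p / c * c := by field_simp
      _ ≤ _ := by gcongr
  nlinarith [mul_nonneg (mul_nonneg (sub_nonneg.mpr hp) hcp.le) (sub_nonneg.mpr ht.2)]

/-- The Rayleigh quotient with weight `(1 - t) ^ m` on `[0, 1]` is at least `1`. -/
lemma integral_weighted_le_integral_weighted_deriv {K : NNReal} {w : ℝ → ℝ}
    (hw : LipschitzOnWith K w (Icc 0 1)) (h0 : w 0 = 0) {p : ℝ} (hp : 1 ≤ p) (m : ℕ) :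
    ∫ t in (0 : ℝ)..1, |w t| ^ p * (1 - t) ^ m ≤
      ∫ t in (0 : ℝ)..1, |deriv w t| ^ p * (1 - t) ^ m := by
  have hpint := intervalIntegrable_abs_deriv_rpow hw hp
  have hcont : Continuous fun t : ℝ => (1 - t) ^ m := by fun_prop
  have hnum : IntervalIntegrable (fun t => |deriv w t| ^ p * (1 - t) ^ m) volume 0 1 :=
    hpint.mul_continuousOn hcont.continuousOn
  have hden : IntervalIntegrable (fun t => |w t| ^ p * (1 - t) ^ m) volume 0 1 := by
    refine ContinuousOn.intervalIntegrable ?_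
    rw [uIcc_of_le zero_le_one]
    exact (hw.continuousOn.abs.rpow_const fun _ _ => Or.inr (by linarith)).mul hcont.continuousOn
  have key : ∀ t ∈ Icc (0 : ℝ) 1, |w t| ^ p * (1 - t) ^ m ≤
      ∫ s in (0 : ℝ)..1, |deriv w s| ^ p * (1 - s) ^ m := by
    intro t ht
    have hsub : uIcc 0 t ⊆ uIcc (0 : ℝ) 1 := by
      rw [uIcc_of_le ht.1, uIcc_of_le zero_le_one]; exact Icc_subset_Icc_right ht.2
    have ht1 : 0 ≤ 1 - t := sub_nonneg.mpr ht.2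
    calc |w t| ^ p * (1 - t) ^ m
        ≤ (∫ s in (0 : ℝ)..t, |deriv w s| ^ p) * (1 - t) ^ m :=
          mul_le_mul_of_nonneg_right (abs_rpow_le_integral_abs_deriv_rpow hw h0 hp ht)
            (pow_nonneg ht1 m)
      _ = ∫ s in (0 : ℝ)..t, |deriv w s| ^ p * (1 - t) ^ m :=
          (intervalIntegral.integral_mul_const _ _).symm
      _ ≤ ∫ s in (0 : ℝ)..t, |deriv w s| ^ p * (1 - s) ^ m := by
          refine intervalIntegral.integral_mono_on ht.1 ((hpint.mono_set hsub).mul_const _)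
            (hnum.mono_set hsub) fun s hs => ?_
          gcongr
          exact hs.2
      _ ≤ _ := by
          refine intervalIntegral.integral_mono_interval le_rfl ht.1 ht.2 ?_ hnum
          filter_upwards [ae_restrict_mem measurableSet_Ioc] with s hs
          have : 0 ≤ 1 - s := sub_nonneg.mpr hs.2
          positivity
  simpa using intervalIntegral.integral_mono_on zero_le_one hden intervalIntegrable_const key

/-- The set of admissible Rayleigh quotients whose infimum is `lambdaG`. -/
def rayleighSet (n : ℕ) (cn p : ℝ) (α : ℝ → ℝ × ℝ) : Set ℝ :=
  {q | ∃ w : ℝ → ℝ, (∃ K, LipschitzOnWith K w (Icc 0 1)) ∧ w 0 = 0 ∧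
    IntervalIntegrable (numG n cn p (Icc 0 1) α w) volume 0 1 ∧
    IntervalIntegrable (denG n cn p (Icc 0 1) α w) volume 0 1 ∧
    (0 < ∫ t in (0:ℝ)..1, denG n cn p (Icc 0 1) α w t) ∧
    q = (∫ t in (0:ℝ)..1, numG n cn p (Icc 0 1) α w t) /
      (∫ t in (0:ℝ)..1, denG n cn p (Icc 0 1) α w t)}

lemma lambdaG_eq_sInf_rayleighSet (n : ℕ) (cn p : ℝ) (α : ℝ → ℝ × ℝ) :
    lambdaG n cn p α = sInf (rayleighSet n cn p α) := rfl

section PowerWeight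

variable {n m : ℕ} {cn p S A : ℝ} {α : ℝ → ℝ × ℝ}

lemma numG_eqOn (hα : ∀ t ∈ Icc (0 : ℝ) 1, gSpeed α t = S)
    (hF : ∀ t ∈ Icc (0 : ℝ) 1, Fvol n cn (α t) = A * (1 - t) ^ m) (w : ℝ → ℝ) :
    EqOn (numG n cn p (Icc 0 1) α w)
      (fun t => A * S ^ (1 - p) * (|deriv w t| ^ p * (1 - t) ^ m)) (uIoo 0 1) := by
  rw [uIoo_of_le zero_le_one]
  intro t ht
  have hs : gSpeedOn (Icc 0 1) α t = S := hα t (Ioo_subset_Icc_self ht)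
  simp only [numG, hs, hF t (Ioo_subset_Icc_self ht),
    derivWithin_of_mem_nhds (Icc_mem_nhds ht.1 ht.2)]
  ring

lemma denG_eqOn (hα : ∀ t ∈ Icc (0 : ℝ) 1, gSpeed α t = S)
    (hF : ∀ t ∈ Icc (0 : ℝ) 1, Fvol n cn (α t) = A * (1 - t) ^ m) (w : ℝ → ℝ) :
    EqOn (denG n cn p (Icc 0 1) α w)
      (fun t => A * S * (|w t| ^ p * (1 - t) ^ m)) (uIoo 0 1) := by
  rw [uIoo_of_le zero_le_one]
  intro t ht
  have hs : gSpeedOn (Icc 0 1) α t = S := hα t (Ioo_subset_Icc_self ht)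
  simp only [denG, hs, hF t (Ioo_subset_Icc_self ht)]
  ring

lemma rpow_neg_le_of_mem_rayleighSet (hS : 0 < S) (hA : 0 < A) (hp : 1 ≤ p)
    (hα : ∀ t ∈ Icc (0 : ℝ) 1, gSpeed α t = S)
    (hF : ∀ t ∈ Icc (0 : ℝ) 1, Fvol n cn (α t) = A * (1 - t) ^ m)
    {q : ℝ} (hq : q ∈ rayleighSet n cn p α) : S ^ (-p) ≤ q := by
  obtain ⟨w, ⟨K, hw⟩, h0, -, -, hpos, rfl⟩ := hq
  have hle := integral_weighted_le_integral_weighted_deriv hw h0 hp m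
  rw [le_div_iff₀ hpos, intervalIntegral.integral_congr_uIoo (numG_eqOn hα hF w),
    intervalIntegral.integral_congr_uIoo (denG_eqOn hα hF w),
    intervalIntegral.integral_const_mul, intervalIntegral.integral_const_mul]
  have hSp : S ^ (1 - p) = S * S ^ (-p) := by
    rw [sub_eq_add_neg, Real.rpow_add hS, Real.rpow_one]
  have hSp' : 0 < S ^ (-p) := Real.rpow_pos_of_pos hS _
  rw [hSp]
  calc _ = A * (S * S ^ (-p)) * ∫ t in (0 : ℝ)..1, |w t| ^ p * (1 - t) ^ m := by ring
    _ ≤ _ := by gcongr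

lemma integral_one_sub_pow (a : ℝ) (m : ℕ) :
    ∫ t in a..1, (1 - t) ^ m = (1 - a) ^ (m + 1) / (m + 1) := by
  rw [intervalIntegral.integral_comp_sub_left (fun x => x ^ m), integral_pow]
  simp

lemma le_integral_abs_rpow_mul_one_sub_pow (hp : 1 ≤ p) (m : ℕ) :
    (3 / 4 : ℝ) ^ p * ((1 / 4) ^ (m + 1) / (m + 1)) ≤
      ∫ t in (0 : ℝ)..1, |t| ^ p * (1 - t) ^ m := by
  have hcont : Continuous fun t : ℝ => |t| ^ p * (1 - t) ^ m :=
    (continuous_abs.rpow_const fun _ => Or.inr (by linarith)).mul (by fun_prop)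
  calc (3 / 4 : ℝ) ^ p * ((1 / 4) ^ (m + 1) / (m + 1))
      = ∫ t in (3 / 4 : ℝ)..1, (3 / 4 : ℝ) ^ p * (1 - t) ^ m := by
        rw [intervalIntegral.integral_const_mul, integral_one_sub_pow]
        norm_num
    _ ≤ ∫ t in (3 / 4 : ℝ)..1, |t| ^ p * (1 - t) ^ m := by
        refine intervalIntegral.integral_mono_on (by norm_num)
          (Continuous.intervalIntegrable (by fun_prop) _ _) (hcont.intervalIntegrable _ _)
          fun t ht => ?_
        have : 0 ≤ 1 - t := sub_nonneg.mpr ht.2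
        gcongr
        exact ht.1.trans (le_abs_self t)
    _ ≤ _ := by
        refine intervalIntegral.integral_mono_interval (by norm_num) (by norm_num) le_rfl ?_
          (hcont.intervalIntegrable _ _)
        filter_upwards [ae_restrict_mem measurableSet_Ioc] with s hs
        have : 0 ≤ 1 - s := sub_nonneg.mpr hs.2
        positivity

lemma exists_mem_rayleighSet_le (hS : 0 < S) (hA : 0 < A) (hp : 1 ≤ p)
    (hα : ∀ t ∈ Icc (0 : ℝ) 1, gSpeed α t = S)
    (hF : ∀ t ∈ Icc (0 : ℝ) 1, Fvol n cn (α t) = A * (1 - t) ^ m) :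
    ∃ q ∈ rayleighSet n cn p α, q * (3 / 4 * S) ^ p ≤ 4 ^ (m + 1) := by
  have hcont : Continuous fun t : ℝ => |t| ^ p * (1 - t) ^ m :=
    (continuous_abs.rpow_const fun _ => Or.inr (by linarith)).mul (by fun_prop)
  have hN := numG_eqOn (p := p) hα hF id
  have hD := denG_eqOn (p := p) hα hF id
  simp only [deriv_id, abs_one, Real.one_rpow, one_mul, id] at hN hD
  have hNval := intervalIntegral.integral_congr_uIoo (μ := volume) hN
  have hDval := intervalIntegral.integral_congr_uIoo (μ := volume) hD
  rw [intervalIntegral.integral_const_mul, integral_one_sub_pow, sub_zero, one_pow] at hNval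
  rw [intervalIntegral.integral_const_mul] at hDval
  have hlow := le_integral_abs_rpow_mul_one_sub_pow hp m
  have hlow' : (0 : ℝ) < (3 / 4 : ℝ) ^ p * ((1 / 4) ^ (m + 1) / (m + 1)) := by positivity
  set I := ∫ t in (0 : ℝ)..1, |t| ^ p * (1 - t) ^ m
  have hI : 0 < I := hlow'.trans_le hlow
  refine ⟨_, ⟨id, ⟨1, LipschitzWith.id.lipschitzOnWith⟩, rfl, ?_, ?_, ?_, rfl⟩, ?_⟩
  · exact IntervalIntegrable.congr_uIoo
      (Continuous.intervalIntegrable (by fun_prop) 0 1) hN.symm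
  · exact IntervalIntegrable.congr_uIoo
      ((hcont.const_mul (A * S)).intervalIntegrable 0 1) hD.symm
  · rw [hDval]; positivity
  · rw [hNval, hDval, div_mul_eq_mul_div, div_le_iff₀ (by positivity)]
    have hSp : S ^ (1 - p) * S ^ p = S := by rw [← Real.rpow_add hS]; simp
    rw [Real.mul_rpow (by norm_num) hS.le]
    calc A * S ^ (1 - p) * (1 / (m + 1)) * ((3 / 4) ^ p * S ^ p)
        = A * (S ^ (1 - p) * S ^ p) * ((3 / 4) ^ p * (1 / (m + 1))) := by ring
      _ = 4 ^ (m + 1) * (A * S * ((3 / 4 : ℝ) ^ p * ((1 / 4) ^ (m + 1) / (m + 1)))) := by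
          rw [hSp, one_div_pow]; field_simp
      _ ≤ 4 ^ (m + 1) * (A * S * I) := by gcongr

lemma rpow_neg_le_lambdaG (hS : 0 < S) (hA : 0 < A) (hp : 1 ≤ p)
    (hα : ∀ t ∈ Icc (0 : ℝ) 1, gSpeed α t = S)
    (hF : ∀ t ∈ Icc (0 : ℝ) 1, Fvol n cn (α t) = A * (1 - t) ^ m) :
    S ^ (-p) ≤ lambdaG n cn p α := by
  obtain ⟨q, hq, -⟩ := exists_mem_rayleighSet_le hS hA hp hα hF
  exact le_csInf ⟨q, hq⟩ fun _ h => rpow_neg_le_of_mem_rayleighSet hS hA hp hα hF h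

lemma lambdaG_mul_rpow_le (hS : 0 < S) (hA : 0 < A) (hp : 1 ≤ p)
    (hα : ∀ t ∈ Icc (0 : ℝ) 1, gSpeed α t = S)
    (hF : ∀ t ∈ Icc (0 : ℝ) 1, Fvol n cn (α t) = A * (1 - t) ^ m) :
    lambdaG n cn p α * (3 / 4 * S) ^ p ≤ 4 ^ (m + 1) := by
  obtain ⟨q, hq, hle⟩ := exists_mem_rayleighSet_le hS hA hp hα hF
  refine le_trans ?_ hle
  rw [lambdaG_eq_sInf_rayleighSet]
  gcongr
  exact csInf_le ⟨_, fun _ h => rpow_neg_le_of_mem_rayleighSet hS hA hp hα hF h⟩ hq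

end PowerWeight

lemma derivWithin_one_sub_mul (R : ℝ) {t : ℝ} (ht : t ∈ Icc (0 : ℝ) 1) :
    derivWithin (fun u : ℝ => (1 - u) * R) (Icc 0 1) t = -R := by
  have h : HasDerivAt (fun u : ℝ => (1 - u) * R) (-R) t := by
    simpa using ((hasDerivAt_id t).const_sub 1).mul_const R
  exact h.hasDerivWithinAt.derivWithin (uniqueDiffOn_Icc_zero_one t ht)

lemma gSpeed_simonsCurve {R : ℝ} (hR : 0 < R) {t : ℝ} (ht : t ∈ Icc (0 : ℝ) 1) :
    gSpeed (simonsCurve R) t = √2 * R := by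
  simp only [gSpeed, gSpeedOn, simonsCurve, derivWithin_one_sub_mul R ht]
  rw [show (-R) ^ 2 + (-R) ^ 2 = 2 * R ^ 2 by ring, Real.sqrt_mul zero_le_two,
    Real.sqrt_sq hR.le]

/-- The vertical segment from `(R, R)` to `(R, 0)`. -/
def verticalSegment (R : ℝ) : ℝ → ℝ × ℝ := fun t => (R, (1 - t) * R)

lemma gSpeed_verticalSegment {R : ℝ} (hR : 0 < R) {t : ℝ} (ht : t ∈ Icc (0 : ℝ) 1) :
    gSpeed (verticalSegment R) t = R := by
  simp only [gSpeed, gSpeedOn, verticalSegment, derivWithin_one_sub_mul R ht,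
    derivWithin_fun_const]
  simp [Real.sqrt_sq hR.le]

lemma memC_verticalSegment {R : ℝ} (hR : 0 < R) : MemC R R (verticalSegment R) := by
  refine ⟨?_, by simp [verticalSegment], fun t ht => ⟨hR, ?_⟩, ?_, ?_, fun t ht => ?_, ?_, ?_⟩
  · unfold verticalSegment
    fun_prop
  · exact mul_pos (sub_pos.mpr ht.2) hR
  · simp [verticalSegment, Pbdry, hR.le]
  · simp [verticalSegment, hR.ne']
  · have h : Lg (verticalSegment R) = ∫ _ in (0 : ℝ)..1, R :=
      intervalIntegral.integral_congr fun s hs =>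
        gSpeed_verticalSegment hR (by rwa [uIcc_of_le zero_le_one] at hs)
    rw [h, gSpeed_verticalSegment hR ht]
    simp
  · intro h
    exact absurd h hR.ne'
  · intro _
    simp [verticalSegment]

/-- For fixed `n ≥ 2` and `x₀ = y₀ = R > 0`, there is `p_n`
such that for every `p ≥ p_n`, `λ_{1,p}(σ) < sup{λ_{1,p}(α) : α ∈ 𝒞}`. -/
theorem simons_stmt2 (n : ℕ) (hn : 2 ≤ n) (cn : ℝ) (hcn : 0 < cn)
    (R : ℝ) (hR : 0 < R) :
    ∃ pn : ℝ, ∀ p : ℝ, pn ≤ p →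
      ∃ α : ℝ → ℝ × ℝ, MemC R R α ∧
        lambdaG n cn p (simonsCurve R) < lambdaG n cn p α := by
  obtain ⟨N, hN⟩ := pow_unbounded_of_one_lt ((4 : ℝ) ^ (2 * (n - 1) + 1))
    (show 1 < 3 / 4 * √2 by nlinarith [Real.sq_sqrt (zero_le_two (α := ℝ)), Real.sqrt_nonneg 2])
  refine ⟨max 1 N, fun p hp => ⟨verticalSegment R, memC_verticalSegment hR, ?_⟩⟩
  have hp1 : 1 ≤ p := (le_max_left _ _).trans hp
  have hpN : (N : ℝ) ≤ p := (le_max_right _ _).trans hp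
  have hb : 1 ≤ 3 / 4 * √2 := by
    nlinarith [Real.sq_sqrt (zero_le_two (α := ℝ)), Real.sqrt_nonneg 2]
  have hA : 0 < cn * R ^ (n - 1) * R ^ (n - 1) := by positivity
  have hup := lambdaG_mul_rpow_le (n := n) (cn := cn) (m := 2 * (n - 1))
    (show 0 < √2 * R by positivity) hA hp1
    (fun t ht => gSpeed_simonsCurve hR ht)
    (fun t _ => by simp only [Fvol, simonsCurve, mul_pow]; ring)
  have hlow := rpow_neg_le_lambdaG (n := n) (cn := cn) (m := n - 1) hR hA hp1
    (fun t ht => gSpeed_verticalSegment hR ht)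
    (fun t _ => by simp only [Fvol, verticalSegment, mul_pow]; ring)
  refine lt_of_lt_of_le ?_ hlow
  have hRp : 0 < R ^ p := Real.rpow_pos_of_pos hR p
  have hbp : (4 : ℝ) ^ (2 * (n - 1) + 1) < (3 / 4 * √2) ^ p := by
    refine hN.trans_le ?_
    rw [← Real.rpow_natCast]
    exact Real.rpow_le_rpow_of_exponent_le hb hpN
  rw [← mul_assoc, Real.mul_rpow (by positivity) hR.le] at hup
  rw [Real.rpow_neg hR.le, ← one_div, lt_div_iff₀ hRp]
  have hpos : 0 < (3 / 4 * √2) ^ p := by positivity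
  refine lt_of_mul_lt_mul_right ?_ hpos.le
  linarith
end
end

section
/- Let γ : [c,d) → P° be locally Lipschitz with γ(c) = (x₀,y₀), ess sup_{t∈[c,d)} |γ'(t)|_h < ∞, x(γ(t))·y(γ(t)) → 0 as t → d, and let L_h(γ) = ∫_c^d |γ'|_h dt > 0. Define ℓ_h : [c,d) → [0,1] by ℓ_h(t) = L_h(γ)^{−1} ∫_c^t |γ'(u)|_h du. Then there exists a curve β ∈ R_h such that β(ℓ_h(t)) = γ(t) for all t ∈ [c,d), |β'(t)|_h = L_h(β) for almost every t ∈ [0,1), L_h(β) = L_h(γ), and λ_{1,p}(β) ≥ λ_{1,p}(γ) for every p ≥ 2n−1, where λ_{1,p}(γ) is defined by the same Rayleigh-quotient formula with test functions w Lipschitz on [c,d] vanishing at c. -/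
open Set MeasureTheory Filter Topology

noncomputable section

theorem eq_zero_of_hasDerivAt_of_monotoneOn_of_eq {f : ℝ → ℝ} {u v x k : ℝ} (huv : u < v)
    (hf : MonotoneOn f (Icc u v)) (h : f u = f v) (hx : x ∈ Icc u v) (hd : HasDerivAt f k x) :
    k = 0 := by
  have hconst : ∀ y ∈ Icc u v, f y = f u := fun y hy =>
    le_antisymm (h ▸ hf hy (right_mem_Icc.2 huv.le) hy.2) (hf (left_mem_Icc.2 huv.le) hy hy.1)
  have h0 : HasDerivWithinAt f 0 (Icc u v) x :=
    (hasDerivWithinAt_const x _ (f u)).congr hconst (hconst x hx)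
  exact (uniqueDiffOn_Icc huv x hx).eq_deriv _ hd.hasDerivWithinAt h0

theorem volume_image_eq_zero_of_lipschitzOnWith {f : ℝ → ℝ} {s t : Set ℝ} {K : NNReal}
    (hf : LipschitzOnWith K f s) (hts : t ⊆ s) (ht : volume t = 0) : volume (f '' t) = 0 := by
  have h := (hf.mono hts).hausdorffMeasure_image_le (d := 1) zero_le_one
  rw [hausdorffMeasure_real, ht, mul_zero] at h
  exact le_antisymm h bot_le

theorem volume_image_eq_zero_of_hasDerivAt_zero {f : ℝ → ℝ} {s : Set ℝ}
    (hf : ∀ x ∈ s, HasDerivAt f 0 x) : volume (f '' s) = 0 := by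
  refine addHaar_image_eq_zero_of_det_fderivWithin_eq_zero volume
    (f' := fun _ => (0 : ℝ →L[ℝ] ℝ)) (fun x hx => ?_) fun x _ => ?_
  · simpa using (hf x hx).hasFDerivAt.hasFDerivWithinAt (s := s)
  · simp [ContinuousLinearMap.det]

/-- A monotone Lipschitz map of `[c,d]` onto `[0,1]`, with almost everywhere derivative `ρ`. -/
structure IsUnitReparam (c d : ℝ) (ℓ ρ : ℝ → ℝ) : Prop where
  lt : c < d
  lipschitz : ∃ K, LipschitzOnWith K ℓ (Icc c d)
  mono : MonotoneOn ℓ (Icc c d)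
  map_left : ℓ c = 0
  map_right : ℓ d = 1
  hasDerivAt : ∀ᵐ t ∂(volume : Measure ℝ), t ∈ Ioo c d → HasDerivAt ℓ (ρ t) t

namespace IsUnitReparam

variable {c d : ℝ} {ℓ ρ : ℝ → ℝ}

theorem mapsTo (h : IsUnitReparam c d ℓ ρ) : MapsTo ℓ (Icc c d) (Icc 0 1) := fun _ ht =>
  ⟨h.map_left ▸ h.mono (left_mem_Icc.2 h.lt.le) ht ht.1,
    h.map_right ▸ h.mono ht (right_mem_Icc.2 h.lt.le) ht.2⟩

theorem surjOn (h : IsUnitReparam c d ℓ ρ) : SurjOn ℓ (Icc c d) (Icc 0 1) := by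
  obtain ⟨K, hK⟩ := h.lipschitz
  have := intermediate_value_Icc h.lt.le hK.continuousOn
  rwa [h.map_left, h.map_right] at this

theorem volume_Icc_diff {P : ℝ → Prop} (hP : ∀ᵐ t ∂(volume : Measure ℝ), t ∈ Ioo c d → P t) :
    volume (Icc c d \ {t | t ∈ Ioo c d ∧ P t}) = 0 := by
  have h : ∀ᵐ t ∂(volume : Measure ℝ), t ∉ Icc c d \ {t | t ∈ Ioo c d ∧ P t} := by
    filter_upwards [hP, Measure.ae_ne volume c, Measure.ae_ne volume d] with t ht hc hd ⟨hI, hn⟩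
    have : t ∈ Ioo c d := ⟨lt_of_le_of_ne hI.1 hc.symm, lt_of_le_of_ne hI.2 hd⟩
    exact hn ⟨this, ht this⟩
  exact measure_eq_zero_iff_ae_notMem.2 h

/-- Change of variables along a monotone, possibly non-injective, reparametrization. -/
theorem change_of_variables (h : IsUnitReparam c d ℓ ρ) {G H : ℝ → ℝ}
    (hGH : ∀ᵐ t ∂(volume : Measure ℝ), t ∈ Ioo c d → H t = ρ t * G (ℓ t)) :
    (IntervalIntegrable G volume 0 1 ↔ IntervalIntegrable H volume c d) ∧
      ∫ t in (0 : ℝ)..1, G t = ∫ t in c..d, H t := by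
  obtain ⟨K, hK⟩ := h.lipschitz
  have hP : ∀ᵐ t ∂(volume : Measure ℝ), t ∈ Ioo c d →
      HasDerivAt ℓ (ρ t) t ∧ H t = ρ t * G (ℓ t) := by
    filter_upwards [h.hasDerivAt, hGH] with t h1 h2 ht using ⟨h1 ht, h2 ht⟩
  set N := toMeasurable volume (Icc c d \ {t | t ∈ Ioo c d ∧
      (HasDerivAt ℓ (ρ t) t ∧ H t = ρ t * G (ℓ t))}) with hN
  have hN0 : volume N = 0 := by rw [hN, measure_toMeasurable, volume_Icc_diff hP]
  set S := Ioo c d \ N with hS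
  have hSm : MeasurableSet S := measurableSet_Ioo.diff (measurableSet_toMeasurable _ _)
  have hSsub : S ⊆ Icc c d := sdiff_subset.trans Ioo_subset_Icc_self
  have hSP : ∀ t ∈ S, HasDerivAt ℓ (ρ t) t ∧ H t = ρ t * G (ℓ t) := by
    intro t ht
    by_contra hcon
    exact ht.2 (subset_toMeasurable _ _ ⟨hSsub ht, fun hm => hcon hm.2⟩)
  have hS0 : volume (Icc c d \ S) = 0 := by
    refine measure_mono_null (t := N ∪ {c, d}) (fun t ht => ?_)
      (measure_union_null hN0 ((Set.toFinite {c, d}).measure_zero _))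
    by_contra hcon
    simp only [mem_union, mem_insert_iff, mem_singleton_iff, not_or] at hcon
    exact ht.2 ⟨⟨lt_of_le_of_ne ht.1.1 (Ne.symm hcon.2.1), lt_of_le_of_ne ht.1.2 hcon.2.2⟩,
      hcon.1⟩
  have himg : (ℓ '' S : Set ℝ) =ᵐ[volume] Icc (0 : ℝ) 1 := by
    refine (h.mapsTo.mono_left hSsub).image_subset.eventuallyLE.antisymm ?_
    refine ae_le_set.2 (measure_mono_null (fun τ hτ => ?_)
      (volume_image_eq_zero_of_lipschitzOnWith hK sdiff_subset hS0))
    obtain ⟨t, ht, rfl⟩ := h.surjOn hτ.1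
    exact ⟨t, ⟨ht, fun hts => hτ.2 ⟨t, hts, rfl⟩⟩, rfl⟩
  have hSIcc : (S : Set ℝ) =ᵐ[volume] Icc c d :=
    hSsub.eventuallyLE.antisymm (ae_le_set.2 hS0)
  have hcongr : EqOn H (fun t => ρ t • G (ℓ t)) S := fun t ht => (hSP t ht).2
  have hd : ∀ t ∈ S, HasDerivWithinAt ℓ (ρ t) S t := fun t ht => (hSP t ht).1.hasDerivWithinAt
  have hm := h.mono.mono hSsub
  constructor
  · rw [intervalIntegrable_iff_integrableOn_Icc_of_le zero_le_one,
      intervalIntegrable_iff_integrableOn_Icc_of_le h.lt.le,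
      ← integrableOn_congr_set_ae himg, ← integrableOn_congr_set_ae hSIcc,
      integrableOn_image_iff_integrableOn_deriv_smul_of_monotoneOn hSm hd hm,
      integrableOn_congr_fun hcongr hSm]
  · rw [intervalIntegral.integral_of_le zero_le_one, intervalIntegral.integral_of_le h.lt.le,
      ← integral_Icc_eq_integral_Ioc, ← integral_Icc_eq_integral_Ioc,
      ← setIntegral_congr_set himg, ← setIntegral_congr_set hSIcc,
      integral_image_eq_integral_deriv_smul_of_monotoneOn hSm hd hm,
      setIntegral_congr_fun hSm hcongr]

/-- Almost every value of a reparametrization is a value at a point with nonzero derivative where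
a given almost everywhere property holds. -/
theorem ae_exists_preimage (h : IsUnitReparam c d ℓ ρ) {P : ℝ → Prop}
    (hP : ∀ᵐ t ∂(volume : Measure ℝ), t ∈ Ioo c d → P t) :
    ∀ᵐ τ ∂(volume : Measure ℝ), τ ∈ Icc (0 : ℝ) 1 →
      ∃ t ∈ Ioo c d, ℓ t = τ ∧ HasDerivAt ℓ (ρ t) t ∧ ρ t ≠ 0 ∧ P t := by
  obtain ⟨K, hK⟩ := h.lipschitz
  have hPd : ∀ᵐ t ∂(volume : Measure ℝ), t ∈ Ioo c d → HasDerivAt ℓ (ρ t) t ∧ P t := by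
    filter_upwards [h.hasDerivAt, hP] with t h1 h2 ht using ⟨h1 ht, h2 ht⟩
  have h1 := volume_image_eq_zero_of_lipschitzOnWith hK sdiff_subset (volume_Icc_diff hPd)
  have h2 : volume (ℓ '' {t | HasDerivAt ℓ 0 t}) = 0 :=
    volume_image_eq_zero_of_hasDerivAt_zero fun _ ht => ht
  filter_upwards [measure_eq_zero_iff_ae_notMem.1 h1, measure_eq_zero_iff_ae_notMem.1 h2]
    with τ hτ1 hτ2 hτ
  obtain ⟨t, ht, rfl⟩ := h.surjOn hτ
  by_cases hg : t ∈ {t | t ∈ Ioo c d ∧ HasDerivAt ℓ (ρ t) t ∧ P t}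
  · exact ⟨t, hg.1, rfl, hg.2.1, fun h0 => hτ2 ⟨t, h0 ▸ hg.2.1, rfl⟩, hg.2.2⟩
  · exact (hτ1 ⟨t, ⟨ht, hg⟩, rfl⟩).elim

theorem lt_map (h : IsUnitReparam c d ℓ ρ) {t u v k : ℝ} (hu : u ∈ Icc c d) (hv : v ∈ Icc c d)
    (huv : u < v) (ht : t = u ∨ t = v) (hd : HasDerivAt ℓ k t) (hk : k ≠ 0) : ℓ u < ℓ v := by
  refine lt_of_le_of_ne (h.mono hu hv huv.le) fun heq => hk ?_
  refine eq_zero_of_hasDerivAt_of_monotoneOn_of_eq huv (h.mono.mono (Icc_subset_Icc hu.1 hv.2))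
    heq ?_ hd
  rcases ht with rfl | rfl
  exacts [left_mem_Icc.2 huv.le, right_mem_Icc.2 huv.le]

theorem map_mem_Ioo (h : IsUnitReparam c d ℓ ρ) {t k : ℝ} (ht : t ∈ Ioo c d)
    (hd : HasDerivAt ℓ k t) (hk : k ≠ 0) : ℓ t ∈ Ioo (0 : ℝ) 1 :=
  ⟨h.map_left ▸ h.lt_map (left_mem_Icc.2 h.lt.le) (Ioo_subset_Icc_self ht) ht.1 (.inr rfl) hd hk,
    h.map_right ▸ h.lt_map (Ioo_subset_Icc_self ht) (right_mem_Icc.2 h.lt.le) ht.2 (.inl rfl) hd hk⟩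

theorem lt_of_map_lt (h : IsUnitReparam c d ℓ ρ) {u v : ℝ} (hu : u ∈ Icc c d) (hv : v ∈ Icc c d)
    (huv : ℓ u < ℓ v) : u < v :=
  lt_of_not_ge fun hvu => huv.not_ge (h.mono hv hu hvu)

theorem rightInv_map (h : IsUnitReparam c d ℓ ρ) {σ : ℝ → ℝ}
    (hσ : ∀ τ ∈ Ico (0 : ℝ) 1, σ τ ∈ Ico c d ∧ ℓ (σ τ) = τ) {t k : ℝ} (ht : t ∈ Ioo c d)
    (hd : HasDerivAt ℓ k t) (hk : k ≠ 0) : σ (ℓ t) = t := by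
  obtain ⟨hm, he⟩ := hσ _ (Ioo_subset_Ico_self (h.map_mem_Ioo ht hd hk))
  rcases lt_trichotomy (σ (ℓ t)) t with hlt | heq | hgt
  · exact absurd he (h.lt_map (Ico_subset_Icc_self hm) (Ioo_subset_Icc_self ht) hlt
      (.inr rfl) hd hk).ne
  · exact heq
  · exact absurd he (h.lt_map (Ioo_subset_Icc_self ht) (Ico_subset_Icc_self hm) hgt
      (.inl rfl) hd hk).ne'

theorem hasDerivAt_rightInv (h : IsUnitReparam c d ℓ ρ) {σ : ℝ → ℝ}
    (hσ : ∀ τ ∈ Ico (0 : ℝ) 1, σ τ ∈ Ico c d ∧ ℓ (σ τ) = τ) {t k : ℝ} (ht : t ∈ Ioo c d)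
    (hd : HasDerivAt ℓ k t) (hk : k ≠ 0) : HasDerivAt σ k⁻¹ (ℓ t) := by
  have hσt := h.rightInv_map hσ ht hd hk
  have hmem := h.map_mem_Ioo ht hd hk
  have hnear : ∀ᶠ τ in 𝓝 (ℓ t), τ ∈ Ico (0 : ℝ) 1 :=
    mem_of_superset (isOpen_Ioo.mem_nhds hmem) Ioo_subset_Ico_self
  refine HasDerivAt.of_local_left_inverse (f := ℓ) ?_ (by rwa [hσt]) hk
    (hnear.mono fun τ hτ => (hσ τ hτ).2)
  refine tendsto_order.2 ⟨fun b hb => ?_, fun b hb => ?_⟩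
  · rw [hσt] at hb
    obtain ⟨b', hb1, hb2⟩ := exists_between (max_lt hb ht.1)
    have hb' : b' ∈ Icc c d := ⟨(le_max_right b c).trans hb1.le, hb2.le.trans ht.2.le⟩
    have hlt := h.lt_map hb' (Ioo_subset_Icc_self ht) hb2 (.inr rfl) hd hk
    filter_upwards [hnear, lt_mem_nhds hlt] with τ hτ hτ'
    refine (le_max_left b c).trans_lt (hb1.trans
      (h.lt_of_map_lt hb' (Ico_subset_Icc_self (hσ τ hτ).1) ?_))
    rwa [(hσ τ hτ).2]
  · rw [hσt] at hb
    obtain ⟨b', hb1, hb2⟩ := exists_between (lt_min hb ht.2)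
    have hb' : b' ∈ Icc c d := ⟨ht.1.le.trans hb1.le, hb2.le.trans (min_le_right b d)⟩
    have hlt := h.lt_map (Ioo_subset_Icc_self ht) hb' hb1 (.inl rfl) hd hk
    filter_upwards [hnear, gt_mem_nhds hlt] with τ hτ hτ'
    refine (h.lt_of_map_lt (Ico_subset_Icc_self (hσ τ hτ).1) hb' ?_).trans
      (hb2.trans_le (min_le_left b d))
    rwa [(hσ τ hτ).2]

end IsUnitReparam

theorem Fvol_pos (n : ℕ) {cn : ℝ} (hcn : 0 < cn) {z : ℝ × ℝ} (hz : z ∈ Pint) :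
    0 < Fvol n cn z := by
  have h1 := hz.1
  have h2 := hz.2
  unfold Fvol
  positivity

theorem continuous_Fvol (n : ℕ) (cn : ℝ) : Continuous (Fvol n cn) := by
  unfold Fvol
  fun_prop

theorem gSpeedOn_nonneg (s : Set ℝ) (α : ℝ → ℝ × ℝ) (t : ℝ) : 0 ≤ gSpeedOn s α t :=
  Real.sqrt_nonneg _

theorem hSpeedOn_nonneg (n : ℕ) {cn : ℝ} (hcn : 0 < cn) {s : Set ℝ} {α : ℝ → ℝ × ℝ} {t : ℝ}
    (ht : α t ∈ Pint) : 0 ≤ hSpeedOn n cn s α t :=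
  mul_nonneg (Fvol_pos n hcn ht).le (gSpeedOn_nonneg s α t)

theorem gSpeedOn_eq_of_mem_nhds {s : Set ℝ} {α : ℝ → ℝ × ℝ} {t : ℝ} (hs : s ∈ 𝓝 t) :
    gSpeedOn s α t =
      Real.sqrt (deriv (fun u => (α u).1) t ^ 2 + deriv (fun u => (α u).2) t ^ 2) := by
  rw [gSpeedOn, derivWithin_of_mem_nhds hs, derivWithin_of_mem_nhds hs]

theorem abs_sub_le_integral_of_abs_deriv_le {f g : ℝ → ℝ} {u v : ℝ} {K : NNReal} (huv : u ≤ v)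
    (hf : LipschitzOnWith K f (Icc u v)) (hg : IntervalIntegrable g volume u v)
    (hfg : ∀ x ∈ Ioo u v, |deriv f x| ≤ g x) : |f v - f u| ≤ ∫ x in u..v, g x := by
  have hac : AbsolutelyContinuousOnInterval f u v :=
    LipschitzOnWith.absolutelyContinuousOnInterval (by rwa [uIcc_of_le huv])
  rw [← hac.integral_deriv_eq_sub]
  exact (intervalIntegral.abs_integral_le_integral_abs huv).trans
    (intervalIntegral.integral_mono_on_of_le_Ioo huv hac.intervalIntegrable_deriv.abs hg hfg)

/-- On a compact piece of the curve, the distance is controlled by the `h`-length. -/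
theorem exists_dist_le_mul_integral_hSpeedOn (n : ℕ) {cn : ℝ} (hcn : 0 < cn) {c d : ℝ}
    {γ : ℝ → ℝ × ℝ} (hγint : ∀ t ∈ Ico c d, γ t ∈ Pint)
    (hγlip : ∀ a ∈ Ico c d, ∃ K, LipschitzOnWith K γ (Icc c a))
    (hint : IntervalIntegrable (hSpeedOn n cn (Ico c d) γ) volume c d) {a : ℝ}
    (ha : a ∈ Ico c d) :
    ∃ C : ℝ, 0 ≤ C ∧ ∀ t ∈ Icc c a, ∀ u ∈ Icc c a,
      dist (γ t) (γ u) ≤ C * |∫ x in t..u, hSpeedOn n cn (Ico c d) γ x| := by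
  obtain ⟨K, hK⟩ := hγlip a ha
  obtain ⟨t₀, ht₀, hmin⟩ := isCompact_Icc.exists_isMinOn (nonempty_Icc.2 ha.1)
    ((continuous_Fvol n cn).comp_continuousOn hK.continuousOn)
  set m := Fvol n cn (γ t₀)
  have hm : 0 < m := Fvol_pos n hcn (hγint t₀ ⟨ht₀.1, ht₀.2.trans_lt ha.2⟩)
  refine ⟨m⁻¹, (inv_pos.2 hm).le, ?_⟩
  have key : ∀ t ∈ Icc c a, ∀ u ∈ Icc c a, t ≤ u →
      dist (γ t) (γ u) ≤ m⁻¹ * |∫ x in t..u, hSpeedOn n cn (Ico c d) γ x| := by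
    intro t ht u hu htu
    have hsub : Icc t u ⊆ Icc c a := Icc_subset_Icc ht.1 hu.2
    have hint' : IntervalIntegrable (fun x => m⁻¹ * hSpeedOn n cn (Ico c d) γ x) volume t u := by
      refine (hint.mono_set ?_).const_mul _
      rw [uIcc_of_le htu, uIcc_of_le (ha.1.trans ha.2.le)]
      exact hsub.trans (Icc_subset_Icc_right ha.2.le)
    have hspeed : ∀ x ∈ Ioo t u,
        Real.sqrt (deriv (fun u => (γ u).1) x ^ 2 + deriv (fun u => (γ u).2) x ^ 2) ≤
          m⁻¹ * hSpeedOn n cn (Ico c d) γ x := by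
      intro x hx
      have hxa : x ∈ Icc c a := hsub (Ioo_subset_Icc_self hx)
      have hnhds : Ico c d ∈ 𝓝 x :=
        Ico_mem_nhds (ht.1.trans_lt hx.1) (hxa.2.trans_lt ha.2)
      rw [← gSpeedOn_eq_of_mem_nhds hnhds, hSpeedOn, ← mul_assoc]
      refine le_mul_of_one_le_left (gSpeedOn_nonneg _ _ _) ?_
      rw [inv_mul_eq_div, one_le_div hm]
      exact hmin hxa
    have h1 := abs_sub_le_integral_of_abs_deriv_le htu
      (LipschitzWith.prod_fst.comp_lipschitzOnWith (hK.mono hsub)) hint' fun x hx =>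
        (Real.abs_le_sqrt (le_add_of_nonneg_right (sq_nonneg _))).trans (hspeed x hx)
    have h2 := abs_sub_le_integral_of_abs_deriv_le htu
      (LipschitzWith.prod_snd.comp_lipschitzOnWith (hK.mono hsub)) hint' fun x hx =>
        (Real.abs_le_sqrt (le_add_of_nonneg_left (sq_nonneg _))).trans (hspeed x hx)
    rw [intervalIntegral.integral_const_mul] at h1 h2
    rw [dist_comm, Prod.dist_eq, Real.dist_eq, Real.dist_eq]
    exact (max_le h1 h2).trans (mul_le_mul_of_nonneg_left (le_abs_self _) (inv_pos.2 hm).le)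
  intro t ht u hu
  rcases le_total t u with htu | hut
  · exact key t ht u hu htu
  · rw [dist_comm, intervalIntegral.integral_symm, abs_neg]
    exact key u hu t ht hut

theorem ae_differentiableAt_of_locally_lipschitz {c d : ℝ} {γ : ℝ → ℝ × ℝ}
    (hγlip : ∀ a ∈ Ico c d, ∃ K, LipschitzOnWith K γ (Icc c a)) :
    ∀ᵐ t ∂(volume : Measure ℝ), t ∈ Ioo c d → DifferentiableAt ℝ γ t := by
  have hbv : LocallyBoundedVariationOn γ (Ico c d) := by
    intro a b ha hb
    obtain ⟨K, hK⟩ := hγlip b hb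
    have h := hK.locallyBoundedVariationOn c b (left_mem_Icc.2 hb.1) (right_mem_Icc.2 hb.1)
    exact h.mono fun x hx => ⟨⟨hx.1.1, hx.2.2⟩, hx.1.1, hx.2.2⟩
  filter_upwards [hbv.ae_differentiableWithinAt_of_mem] with t ht htI
  exact (ht (Ioo_subset_Ico_self htI)).differentiableAt (Ico_mem_nhds htI.1 htI.2)

theorem hSpeed_comp (n : ℕ) (cn : ℝ) {c d : ℝ} {γ : ℝ → ℝ × ℝ} {σ : ℝ → ℝ} {t τ k : ℝ}
    (ht : t ∈ Ioo c d) (hτ : τ ∈ Ioo (0 : ℝ) 1) (hσ : HasDerivAt σ k⁻¹ τ) (hστ : σ τ = t)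
    (hk : 0 < k) (hγ : DifferentiableAt ℝ γ t) :
    hSpeed n cn (γ ∘ σ) τ = hSpeedOn n cn (Ico c d) γ t / k := by
  subst hστ
  have h1 : HasDerivAt (fun u => ((γ ∘ σ) u).1) (deriv (fun u => (γ u).1) (σ τ) * k⁻¹) τ :=
    (hγ.fst.hasDerivAt).comp τ hσ
  have h2 : HasDerivAt (fun u => ((γ ∘ σ) u).2) (deriv (fun u => (γ u).2) (σ τ) * k⁻¹) τ :=
    (hγ.snd.hasDerivAt).comp τ hσ
  rw [hSpeed, hSpeedOn, hSpeedOn, gSpeedOn_eq_of_mem_nhds (Ico_mem_nhds ht.1 ht.2),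
    gSpeedOn_eq_of_mem_nhds (Ico_mem_nhds hτ.1 hτ.2), h1.deriv, h2.deriv, mul_pow, mul_pow,
    ← add_mul, Real.sqrt_mul (by positivity), Real.sqrt_sq (inv_pos.2 hk).le, div_eq_mul_inv,
    mul_assoc]
  rfl

theorem hasDerivAt_comp_zero_of_lipschitzOnWith {w ℓ : ℝ → ℝ} {K : NNReal} {s : Set ℝ} {t : ℝ}
    (hw : LipschitzOnWith K w s) (hℓ : HasDerivAt ℓ 0 t) (hs : ∀ᶠ u in 𝓝 t, ℓ u ∈ s) :
    HasDerivAt (w ∘ ℓ) 0 t := by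
  have h := hℓ.isLittleO
  simp only [smul_zero, sub_zero] at h
  refine HasDerivAt.of_isLittleO ?_
  simp only [smul_zero, sub_zero]
  refine (Asymptotics.IsBigO.of_bound K ?_).trans_isLittleO h
  filter_upwards [hs] with u hu
  simpa [dist_eq_norm] using hw.dist_le_mul _ hu _ hs.self_of_nhds

section ArcLength

variable {n : ℕ} {cn c d L : ℝ} {γ : ℝ → ℝ × ℝ} {ℓ σ : ℝ → ℝ}

/-- At a point of positive speed, the arc length reparametrization has constant `h`-speed. -/
theorem hSpeed_reparam_eq
    (h : IsUnitReparam c d ℓ fun t => hSpeedOn n cn (Ico c d) γ t / L)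
    (hσ : ∀ τ ∈ Ico (0 : ℝ) 1, σ τ ∈ Ico c d ∧ ℓ (σ τ) = τ) (hL : 0 < L) {t : ℝ}
    (ht : t ∈ Ioo c d) (hγ : DifferentiableAt ℝ γ t)
    (hd : HasDerivAt ℓ (hSpeedOn n cn (Ico c d) γ t / L) t)
    (hs : 0 < hSpeedOn n cn (Ico c d) γ t) :
    hSpeed n cn (γ ∘ σ) (ℓ t) = L := by
  have hk := div_pos hs hL
  rw [hSpeed_comp n cn ht (h.map_mem_Ioo ht hd hk.ne') (h.hasDerivAt_rightInv hσ ht hd hk.ne')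
    (h.rightInv_map hσ ht hd hk.ne') hk hγ]
  field_simp

theorem denH_comp_ae (hcn : 0 < cn)
    (h : IsUnitReparam c d ℓ fun t => hSpeedOn n cn (Ico c d) γ t / L)
    (hσ : ∀ τ ∈ Ico (0 : ℝ) 1, σ τ ∈ Ico c d ∧ ℓ (σ τ) = τ) (hL : 0 < L)
    (hγint : ∀ t ∈ Ico c d, γ t ∈ Pint)
    (hγd : ∀ᵐ t ∂(volume : Measure ℝ), t ∈ Ioo c d → DifferentiableAt ℝ γ t)
    (p : ℝ) (w : ℝ → ℝ) :
    ∀ᵐ t ∂(volume : Measure ℝ), t ∈ Ioo c d →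
      denH n cn p (Ico c d) γ (w ∘ ℓ) t =
        hSpeedOn n cn (Ico c d) γ t / L * denH n cn p (Ico 0 1) (γ ∘ σ) w (ℓ t) := by
  filter_upwards [hγd, h.hasDerivAt] with t h1 h2 ht
  rw [denH, denH]
  rcases (hSpeedOn_nonneg n hcn (s := Ico c d) (hγint t (Ioo_subset_Ico_self ht))).eq_or_lt
    with hs | hs
  · simp [← hs]
  · have := hSpeed_reparam_eq h hσ hL ht (h1 ht) (h2 ht) hs
    rw [hSpeed] at this
    rw [this, Function.comp_apply]
    field_simp

theorem numH_comp_ae (hcn : 0 < cn)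
    (h : IsUnitReparam c d ℓ fun t => hSpeedOn n cn (Ico c d) γ t / L)
    (hσ : ∀ τ ∈ Ico (0 : ℝ) 1, σ τ ∈ Ico c d ∧ ℓ (σ τ) = τ) (hL : 0 < L)
    (hγint : ∀ t ∈ Ico c d, γ t ∈ Pint)
    (hγd : ∀ᵐ t ∂(volume : Measure ℝ), t ∈ Ioo c d → DifferentiableAt ℝ γ t)
    {p : ℝ} (hp : 0 < p) {w : ℝ → ℝ} {K : NNReal} (hw : LipschitzOnWith K w (Icc 0 1)) :
    ∀ᵐ t ∂(volume : Measure ℝ), t ∈ Ioo c d →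
      numH n cn p c d (Ico c d) γ (w ∘ ℓ) t =
        hSpeedOn n cn (Ico c d) γ t / L * numH n cn p 0 1 (Ico 0 1) (γ ∘ σ) w (ℓ t) := by
  obtain ⟨Kℓ, hKℓ⟩ := h.lipschitz
  filter_upwards [hγd, h.hasDerivAt,
    (hw.comp hKℓ h.mapsTo).ae_differentiableWithinAt_of_mem_real] with t h1 h2 h3 ht
  have hnhds : Icc c d ∈ 𝓝 t := Icc_mem_nhds ht.1 ht.2
  rw [numH, numH, derivWithin_of_mem_nhds hnhds]
  rcases (hSpeedOn_nonneg n hcn (s := Ico c d) (hγint t (Ioo_subset_Ico_self ht))).eq_or_lt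
    with hs | hs
  · have hd := h2 ht
    rw [← hs, zero_div] at hd
    have hv := hasDerivAt_comp_zero_of_lipschitzOnWith hw hd
      (mem_of_superset hnhds fun u hu => h.mapsTo hu)
    rw [hv.deriv, ← hs, abs_zero, Real.zero_rpow hp.ne']
    simp
  · have hk := div_pos hs hL
    have hspeed := hSpeed_reparam_eq h hσ hL ht (h1 ht) (h2 ht) hs
    have hmem := h.map_mem_Ioo ht (h2 ht) hk.ne'
    have hσt := h.rightInv_map hσ ht (h2 ht) hk.ne'
    have hv := ((h3 (Ioo_subset_Icc_self ht)).differentiableAt hnhds).hasDerivAt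
    have hwd : HasDerivAt w (deriv (w ∘ ℓ) t * (hSpeedOn n cn (Ico c d) γ t / L)⁻¹) (ℓ t) := by
      have hcomp := HasDerivAt.comp (h₂ := w ∘ ℓ) (ℓ t) (by rwa [hσt])
        (h.hasDerivAt_rightInv hσ ht (h2 ht) hk.ne')
      refine hcomp.congr_of_eventuallyEq ?_
      filter_upwards [Ioo_mem_nhds hmem.1 hmem.2] with τ hτ
      simp [(hσ τ (Ioo_subset_Ico_self hτ)).2]
    rw [hSpeed] at hspeed
    rw [derivWithin_of_mem_nhds (Icc_mem_nhds hmem.1 hmem.2), hwd.deriv, hspeed,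
      Function.comp_apply (f := γ), hσt, abs_mul, abs_inv, abs_of_pos hk,
      Real.mul_rpow (abs_nonneg _) (inv_pos.2 hk).le, Real.inv_rpow hk.le]
    have hsk : hSpeedOn n cn (Ico c d) γ t = hSpeedOn n cn (Ico c d) γ t / L * L := by
      field_simp
    set k := hSpeedOn n cn (Ico c d) γ t / L
    rw [hsk, Real.mul_rpow hk.le hL.le, Real.rpow_sub hk, Real.rpow_one]
    ring

end ArcLength

theorem lambdaHOn_le_of_reparam {n : ℕ} {cn c d L : ℝ} {γ : ℝ → ℝ × ℝ} {ℓ σ : ℝ → ℝ}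
    (hcn : 0 < cn)
    (h : IsUnitReparam c d ℓ fun t => hSpeedOn n cn (Ico c d) γ t / L)
    (hσ : ∀ τ ∈ Ico (0 : ℝ) 1, σ τ ∈ Ico c d ∧ ℓ (σ τ) = τ) (hL : 0 < L)
    (hγint : ∀ t ∈ Ico c d, γ t ∈ Pint)
    (hγd : ∀ᵐ t ∂(volume : Measure ℝ), t ∈ Ioo c d → DifferentiableAt ℝ γ t)
    (hβc : ContinuousOn (γ ∘ σ) (Ico 0 1))
    (hβt : Tendsto (fun t => ((γ ∘ σ) t).1 * ((γ ∘ σ) t).2) (𝓝[<] (1 : ℝ)) (𝓝 0))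
    (hβs : ∀ᵐ t ∂(volume : Measure ℝ), t ∈ Ico (0 : ℝ) 1 → hSpeed n cn (γ ∘ σ) t = L)
    {p : ℝ} (hp : 0 < p) :
    lambdaHOn n cn p c d (Ico c d) γ ≤ lambdaH n cn p (γ ∘ σ) := by
  have hβint : ∀ t ∈ Ico (0 : ℝ) 1, (γ ∘ σ) t ∈ Pint := fun t ht => hγint _ (hσ t ht).1
  refine csInf_le_csInf ⟨0, ?_⟩ ?_ ?_
  · rintro q ⟨w, -, -, -, -, hpos, rfl⟩
    refine div_nonneg (intervalIntegral.integral_nonneg_of_ae_restrict h.lt.le ?_) hpos.le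
    rw [← restrict_Ico_eq_restrict_Icc]
    refine (ae_restrict_iff' measurableSet_Ico).2 (.of_forall fun t ht => ?_)
    have h1 := (Fvol_pos n hcn (hγint t ht)).le
    have h2 := hSpeedOn_nonneg n hcn (s := Ico c d) (hγint t ht)
    simp only [numH, Pi.zero_apply]
    positivity
  · have hmem : ∀ᵐ t ∂(volume : Measure ℝ), t ∈ uIoc (0 : ℝ) 1 →
        t ∈ Ioo (0 : ℝ) 1 ∧ hSpeed n cn (γ ∘ σ) t = L := by
      filter_upwards [hβs, Measure.ae_ne volume (1 : ℝ)] with t ht h1 hI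
      rw [uIoc_of_le zero_le_one] at hI
      have hI' : t ∈ Ioo (0 : ℝ) 1 := ⟨hI.1, lt_of_le_of_ne hI.2 h1⟩
      exact ⟨hI', ht (Ioo_subset_Ico_self hI')⟩
    have hden : ∀ᵐ t ∂(volume : Measure ℝ), t ∈ uIoc (0 : ℝ) 1 →
        |t| ^ p * L = denH n cn p (Ico 0 1) (γ ∘ σ) id t := by
      filter_upwards [hmem] with t ht hI
      rw [denH, ← (ht hI).2, hSpeed, id]
    have hnum : ∀ᵐ t ∂(volume : Measure ℝ), t ∈ uIoc (0 : ℝ) 1 →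
        Fvol n cn ((γ ∘ σ) t) ^ p * L ^ (1 - p) =
          numH n cn p 0 1 (Ico 0 1) (γ ∘ σ) id t := by
      filter_upwards [hmem] with t ht hI
      rw [numH, ← (ht hI).2, hSpeed,
        derivWithin_of_mem_nhds (Icc_mem_nhds (ht hI).1.1 (ht hI).1.2), deriv_id, abs_one,
        Real.one_rpow, one_mul]
    have hcont : ContinuousOn (fun t => Fvol n cn ((γ ∘ σ) t) ^ p * L ^ (1 - p)) (Ico 0 1) :=
      (((continuous_Fvol n cn).comp_continuousOn hβc).rpow_const fun _ _ => .inr hp.le).mul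
        continuousOn_const
    have hlim : Tendsto (fun t => Fvol n cn ((γ ∘ σ) t) ^ p * L ^ (1 - p)) (𝓝[<] (1 : ℝ))
        (𝓝 ((cn * 0 ^ (n - 1)) ^ p * L ^ (1 - p))) := by
      refine Tendsto.mul_const _ (Tendsto.rpow_const ?_ (.inr hp.le))
      refine ((hβt.pow (n - 1)).const_mul cn).congr fun t => ?_
      rw [Fvol, mul_pow, mul_assoc]
    have hstart : Tendsto (fun t => Fvol n cn ((γ ∘ σ) t) ^ p * L ^ (1 - p)) (𝓝[>] (0 : ℝ))
        (𝓝 (Fvol n cn ((γ ∘ σ) 0) ^ p * L ^ (1 - p))) := by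
      rw [← nhdsWithin_Ioo_eq_nhdsGT zero_lt_one]
      exact (hcont 0 ⟨le_rfl, zero_lt_one⟩).mono_left (nhdsWithin_mono _ Ioo_subset_Ico_self)
    have hcont' := hcont.mono Ioo_subset_Ico_self
    have hnumint : IntervalIntegrable
        (fun t => Fvol n cn ((γ ∘ σ) t) ^ p * L ^ (1 - p)) volume 0 1 := by
      refine ((continuousOn_Icc_extendFrom_Ioo hcont' hstart
        hlim).intervalIntegrable_of_Icc zero_le_one).congr_uIoo ?_
      rw [uIoo_of_le zero_le_one]
      exact fun t ht => extendFrom_extends hcont' t ht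
    have hdencont : Continuous fun t : ℝ => |t| ^ p * L :=
      (continuous_abs.rpow_const fun _ => .inr hp.le).mul continuous_const
    refine ⟨_, id, ⟨1, LipschitzWith.id.lipschitzOnWith⟩, rfl,
      hnumint.congr_ae ((ae_restrict_iff' measurableSet_uIoc).2 hnum),
      (hdencont.intervalIntegrable 0 1).congr_ae ((ae_restrict_iff' measurableSet_uIoc).2 hden),
      ?_, rfl⟩
    rw [← intervalIntegral.integral_congr_ae hden]
    refine intervalIntegral.intervalIntegral_pos_of_pos_on (hdencont.intervalIntegrable 0 1)
      (fun t ht => ?_) zero_lt_one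
    have := abs_pos.2 ht.1.ne'
    positivity
  · rintro q ⟨w, ⟨K, hw⟩, hw0, hni, hdi, hpos, rfl⟩
    obtain ⟨Kℓ, hKℓ⟩ := h.lipschitz
    obtain ⟨hn1, hn2⟩ := h.change_of_variables (numH_comp_ae hcn h hσ hL hγint hγd hp hw)
    obtain ⟨hd1, hd2⟩ := h.change_of_variables (denH_comp_ae hcn h hσ hL hγint hγd p w)
    refine ⟨w ∘ ℓ, ⟨_, hw.comp hKℓ h.mapsTo⟩, ?_, hn1.1 hni, hd1.1 hdi, hd2 ▸ hpos, ?_⟩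
    · rw [Function.comp_apply, h.map_left, hw0]
    · rw [hn2, hd2]

/-- Reparametrization by `h`-arc length: a locally Lipschitz
curve `γ : [c,d) → P°` from `(x₀,y₀)` with essentially bounded `h`-speed, with
`x·y → 0` at `d` and positive `h`-length, can be reparametrized to a constant
`h`-speed curve `β ∈ R_h` of the same `h`-length whose eigenvalue does not
decrease, for every `p ≥ 2n-1`. -/
theorem simons_stmt4 (n : ℕ) (hn : 2 ≤ n) (cn : ℝ) (hcn : 0 < cn)
    (x0 y0 : ℝ) (hy0 : 0 < y0) (hxy : y0 ≤ x0)
    (c d : ℝ) (hcd : c < d) (γ : ℝ → ℝ × ℝ)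
    (hγc : γ c = (x0, y0))
    (hγint : ∀ t ∈ Ico c d, γ t ∈ Pint)
    (hγlip : ∀ a ∈ Ico c d, ∃ K, LipschitzOnWith K γ (Icc c a))
    (hγess : ∃ M : ℝ, ∀ᵐ t ∂(volume : Measure ℝ),
      t ∈ Ico c d → hSpeedOn n cn (Ico c d) γ t ≤ M)
    (hγtend : Tendsto (fun t => (γ t).1 * (γ t).2) (𝓝[<] d) (𝓝 0))
    (hLpos : 0 < ∫ t in c..d, hSpeedOn n cn (Ico c d) γ t) :
    ∃ β : ℝ → ℝ × ℝ, MemRh n cn x0 y0 β ∧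
      (∀ t ∈ Ico c d,
        β ((∫ u in c..t, hSpeedOn n cn (Ico c d) γ u) /
            (∫ u in c..d, hSpeedOn n cn (Ico c d) γ u)) = γ t) ∧
      (∀ᵐ t ∂(volume : Measure ℝ), t ∈ Ico (0:ℝ) 1 →
        hSpeed n cn β t = Lh n cn β) ∧
      Lh n cn β = (∫ t in c..d, hSpeedOn n cn (Ico c d) γ t) ∧
      ∀ p : ℝ, 2 * (n : ℝ) - 1 ≤ p →
        lambdaHOn n cn p c d (Ico c d) γ ≤ lambdaH n cn p β := by
  obtain ⟨M, hM⟩ := hγess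
  set s := hSpeedOn n cn (Ico c d) γ with hs
  set L := ∫ t in c..d, s t with hL
  set ℓ : ℝ → ℝ := fun t => (∫ u in c..t, s u) / L with hℓ
  have hint : IntervalIntegrable s volume c d := by
    by_contra hcon
    exact hLpos.ne' (intervalIntegral.integral_undef hcon)
  have hs0 : ∀ t ∈ Ico c d, 0 ≤ s t := fun t ht => hSpeedOn_nonneg n hcn (hγint t ht)
  have hsub : ∀ t ∈ Icc c d, ∀ u ∈ Icc c d, IntervalIntegrable s volume t u := fun t ht u hu =>
    hint.mono_set (by rw [uIcc_of_le hcd.le]; exact ordConnected_Icc.uIcc_subset ht hu)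
  have hcI : c ∈ Icc c d := left_mem_Icc.2 hcd.le
  have hdiff : ∀ t ∈ Icc c d, ∀ u ∈ Icc c d, ∫ x in t..u, s x = L * (ℓ u - ℓ t) := by
    intro t ht u hu
    rw [← intervalIntegral.integral_interval_sub_left (hsub c hcI u hu) (hsub c hcI t ht)]
    simp only [hℓ]
    field_simp
  have hrep : IsUnitReparam c d ℓ fun t => s t / L := by
    refine ⟨hcd, ⟨Real.toNNReal (M / L), ?_⟩, ?_, by simp [hℓ], div_self hLpos.ne', ?_⟩
    · refine LipschitzOnWith.of_dist_le_mul fun u hu t ht => ?_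
      have h1 : ‖∫ x in t..u, s x‖ ≤ M * |u - t| := by
        refine intervalIntegral.norm_integral_le_of_norm_le_const_ae ?_
        filter_upwards [hM, Measure.ae_ne volume d] with x hx hxd hxI
        have hxI' := (ordConnected_Icc (a := c) (b := d)).uIcc_subset ht hu
          (uIoc_subset_uIcc hxI)
        have hxm : x ∈ Ico c d := ⟨hxI'.1, lt_of_le_of_ne hxI'.2 hxd⟩
        rw [Real.norm_of_nonneg (hs0 x hxm)]
        exact hx hxm
      rw [hdiff t ht u hu, norm_mul, Real.norm_of_nonneg hLpos.le] at h1
      rw [dist_eq_norm, Real.dist_eq]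
      refine le_trans ?_ (mul_le_mul_of_nonneg_right (Real.le_coe_toNNReal _) (abs_nonneg _))
      rw [div_mul_eq_mul_div, le_div_iff₀ hLpos, mul_comm]
      exact h1
    · intro t ht u hu htu
      have h1 : 0 ≤ ∫ x in t..u, s x := by
        refine intervalIntegral.integral_nonneg_of_ae_restrict htu ?_
        rw [← restrict_Ico_eq_restrict_Icc]
        exact (ae_restrict_iff' measurableSet_Ico).2
          (.of_forall fun x hx => hs0 x ⟨ht.1.trans hx.1, hx.2.trans_le hu.2⟩)
      rw [hdiff t ht u hu] at h1
      exact sub_nonneg.1 (nonneg_of_mul_nonneg_right h1 hLpos)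
    · filter_upwards [hint.ae_hasDerivAt_integral] with t ht htI
      rw [uIcc_of_le hcd.le] at ht
      exact (ht (Ioo_subset_Icc_self htI) c hcI).div_const L
  have hγd := ae_differentiableAt_of_locally_lipschitz hγlip
  have hdist : ∀ a ∈ Ico c d, ∃ C : ℝ, 0 ≤ C ∧ ∀ t ∈ Icc c a, ∀ u ∈ Icc c a,
      dist (γ t) (γ u) ≤ C * dist (ℓ t) (ℓ u) := by
    intro a ha
    obtain ⟨C, hC, h⟩ := exists_dist_le_mul_integral_hSpeedOn n hcn hγint hγlip hint ha
    refine ⟨C * L, mul_nonneg hC hLpos.le, fun t ht u hu => (h t ht u hu).trans_eq ?_⟩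
    have hsubd : Icc c a ⊆ Icc c d := Icc_subset_Icc_right ha.2.le
    rw [← hs, hdiff t (hsubd ht) u (hsubd hu), abs_mul, abs_of_pos hLpos, dist_comm,
      Real.dist_eq, mul_assoc]
  have hfiber : ∀ t ∈ Ico c d, ∀ u ∈ Ico c d, ℓ t = ℓ u → γ t = γ u := by
    intro t ht u hu h
    obtain ⟨C, -, hC⟩ := hdist (max t u) ⟨ht.1.trans (le_max_left _ _), max_lt ht.2 hu.2⟩
    refine dist_le_zero.1 ((hC t ⟨ht.1, le_max_left _ _⟩ u ⟨hu.1, le_max_right _ _⟩).trans ?_)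
    rw [h, dist_self, mul_zero]
  have hlt : ∀ t ∈ Ico c d, ℓ t < 1 := by
    intro t ht
    refine lt_of_le_of_ne (hrep.mapsTo (Ico_subset_Icc_self ht)).2 fun h1 => ?_
    have hconst : (fun _ : ℝ => (γ t).1 * (γ t).2) =ᶠ[𝓝[<] d]
        fun u => (γ u).1 * (γ u).2 := by
      filter_upwards [Ioo_mem_nhdsLT ht.2] with u hu
      have huI : u ∈ Ico c d := ⟨ht.1.trans hu.1.le, hu.2⟩
      have h2 : ℓ t ≤ ℓ u :=
        hrep.mono (Ico_subset_Icc_self ht) (Ico_subset_Icc_self huI) hu.1.le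
      rw [hfiber t ht u huI (h2.antisymm
        ((hrep.mapsTo (Ico_subset_Icc_self huI)).2.trans_eq h1.symm))]
    have h0 := tendsto_nhds_unique (tendsto_const_nhds.congr' hconst) hγtend
    exact (mul_pos (hγint t ht).1 (hγint t ht).2).ne' h0
  have hex : ∀ τ ∈ Ico (0 : ℝ) 1, ∃ t, t ∈ Ico c d ∧ ℓ t = τ := by
    intro τ hτ
    obtain ⟨t, ht, h⟩ := hrep.surjOn (Ico_subset_Icc_self hτ)
    refine ⟨t, ⟨ht.1, lt_of_le_of_ne ht.2 fun htd => ?_⟩, h⟩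
    rw [htd, hrep.map_right] at h
    exact hτ.2.ne' h
  choose! σ hσ using hex
  have hmaps : ∀ t ∈ Ico c d, ℓ t ∈ Ico (0 : ℝ) 1 := fun t ht =>
    ⟨(hrep.mapsTo (Ico_subset_Icc_self ht)).1, hlt t ht⟩
  have hβℓ : ∀ t ∈ Ico c d, (γ ∘ σ) (ℓ t) = γ t := fun t ht =>
    hfiber _ (hσ _ (hmaps t ht)).1 t ht (hσ _ (hmaps t ht)).2
  have hσlt : ∀ τ ∈ Ico (0 : ℝ) 1, ∀ t ∈ Ico c d, ℓ t < τ → t < σ τ := fun τ hτ t ht h =>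
    hrep.lt_of_map_lt (Ico_subset_Icc_self ht) (Ico_subset_Icc_self (hσ τ hτ).1)
      (by rwa [(hσ τ hτ).2])
  have hβlip : ∀ a ∈ Ico (0 : ℝ) 1, ∃ K, LipschitzOnWith K (γ ∘ σ) (Icc 0 a) := by
    intro a ha
    obtain ⟨C, hC0, hC⟩ := hdist (σ a) (hσ a ha).1
    have hmem : ∀ τ ∈ Icc 0 a, σ τ ∈ Icc c (σ a) ∧ ℓ (σ τ) = τ := by
      intro τ hτ
      have hτ1 : τ ∈ Ico (0 : ℝ) 1 := ⟨hτ.1, hτ.2.trans_lt ha.2⟩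
      refine ⟨⟨(hσ τ hτ1).1.1, ?_⟩, (hσ τ hτ1).2⟩
      rcases hτ.2.eq_or_lt with rfl | h
      · exact le_rfl
      · exact (hσlt a ha _ (hσ τ hτ1).1 (by rwa [(hσ τ hτ1).2])).le
    refine ⟨Real.toNNReal C, LipschitzOnWith.of_dist_le_mul fun τ hτ τ' hτ' => ?_⟩
    have h := hC _ (hmem τ hτ).1 _ (hmem τ' hτ').1
    rwa [(hmem τ hτ).2, (hmem τ' hτ').2, ← Real.coe_toNNReal C hC0] at h
  have hβc : ContinuousOn (γ ∘ σ) (Ico 0 1) := by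
    intro τ hτ
    obtain ⟨a, ha1, ha2⟩ := exists_between hτ.2
    obtain ⟨K, hK⟩ := hβlip a ⟨hτ.1.trans ha1.le, ha2⟩
    refine (hK.continuousOn τ ⟨hτ.1, ha1.le⟩).mono_of_mem_nhdsWithin ?_
    filter_upwards [self_mem_nhdsWithin, mem_nhdsWithin_of_mem_nhds (gt_mem_nhds ha1)]
      with x hx hxa using ⟨hx.1, hxa.le⟩
  have hσtend : Tendsto σ (𝓝[<] (1 : ℝ)) (𝓝[<] d) := by
    refine tendsto_nhdsWithin_iff.2 ⟨tendsto_order.2 ⟨fun b hb => ?_, fun b hb => ?_⟩, ?_⟩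
    · have hm : max b c ∈ Ico c d := ⟨le_max_right _ _, max_lt hb hcd⟩
      filter_upwards [Ioo_mem_nhdsLT (hlt _ hm)] with τ hτ
      exact (le_max_left b c).trans_lt
        (hσlt τ ⟨(hmaps _ hm).1.trans hτ.1.le, hτ.2⟩ _ hm hτ.1)
    · filter_upwards [Ioo_mem_nhdsLT zero_lt_one] with τ hτ
      exact (hσ τ (Ioo_subset_Ico_self hτ)).1.2.trans hb
    · filter_upwards [Ioo_mem_nhdsLT zero_lt_one] with τ hτ
      exact (hσ τ (Ioo_subset_Ico_self hτ)).1.2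
  have hβt := hγtend.comp hσtend
  have hβs : ∀ᵐ τ ∂(volume : Measure ℝ), τ ∈ Ico (0 : ℝ) 1 → hSpeed n cn (γ ∘ σ) τ = L := by
    filter_upwards [hrep.ae_exists_preimage hγd] with τ hτ hI
    obtain ⟨t, ht, rfl, hd, hne, hdiffγ⟩ := hτ (Ico_subset_Icc_self hI)
    exact hSpeed_reparam_eq hrep hσ hLpos ht hdiffγ hd ((hs0 t (Ioo_subset_Ico_self ht)).lt_of_ne'
      fun h0 => hne (by rw [h0, zero_div]))
  have hLβ : Lh n cn (γ ∘ σ) = L := by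
    rw [Lh, intervalIntegral.integral_congr_ae (g := fun _ => L)]
    · simp
    · filter_upwards [hβs, Measure.ae_ne volume (1 : ℝ)] with τ hτ h1 hI
      rw [uIoc_of_le zero_le_one] at hI
      exact hτ ⟨hI.1.le, lt_of_le_of_ne hI.2 h1⟩
  refine ⟨γ ∘ σ, ⟨?_, fun τ hτ => hγint _ (hσ τ hτ).1, hβlip, ⟨L, ?_⟩, hβt⟩, hβℓ, ?_, hLβ,
    fun p hp => ?_⟩
  · have h := hβℓ c ⟨le_rfl, hcd⟩
    rwa [hrep.map_left, hγc] at h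
  · filter_upwards [hβs] with τ hτ hI using (hτ hI).le
  · rwa [hLβ]
  · have hn' : (2 : ℝ) ≤ n := by exact_mod_cast hn
    exact lambdaHOn_le_of_reparam hcn hrep hσ hLpos hγint hγd hβc hβt hβs (by linarith)
end
end
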